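/- Let n ≥ 1 and let w ∈ {A,D,T}^{n-1}. There is exactly one parking function of length n with statistic encoding w if and only if w has the form A^a T^b (some number of A's followed by some number of T's, with a + b = n−1) or the form T^a D^b (some number of T's followed by some number of D's, with a + b = n−1). -/

import Mathlib

open scoped Classical

/-- `f : Fin n → Fin n` (entries 0-indexed, value `v` encodes preference `v+1`) is a
parking function: some rearrangement `f ∘ σ` is nondecreasing and its `i`-th entry
(0-indexed) is at most `i`. -/
def IsPF {n : ℕ} (f : Fin n → Fin n) : Prop :=
  ∃ σ : Equiv.Perm (Fin n), Monotone (f ∘ σ) ∧ ∀ i : Fin n, (f (σ i) : ℕ) ≤ (i : ℕ)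

/-- The alphabet {A, D, T}: ascent, descent, tie. -/
inductive Letter : Type
  | A : Letter
  | D : Letter
  | T : Letter
deriving DecidableEq

/-- The statistic encoding of a tuple `a_1, …, a_n`: the word `w_1 ⋯ w_{n-1}` with
`w_i = A` if `a_i < a_{i+1}`, `w_i = D` if `a_i > a_{i+1}`, and `w_i = T` if
`a_i = a_{i+1}`.  (Position `i` of the word is the entry at `Fin`-index `i - 1`.) -/
def statEnc {n : ℕ} (f : Fin n → Fin n) : Fin (n - 1) → Letter := fun i =>
  if f ⟨(i : ℕ), by have := i.isLt; omega⟩ < f ⟨(i : ℕ) + 1, by have := i.isLt; omega⟩ then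
    Letter.A
  else if f ⟨(i : ℕ) + 1, by have := i.isLt; omega⟩ < f ⟨(i : ℕ), by have := i.isLt; omega⟩ then
    Letter.D
  else Letter.T

/-- Parking functions are characterised by counting small entries. -/
lemma isPF_iff_card {n : ℕ} (f : Fin n → Fin n) :
    IsPF f ↔ ∀ k ≤ n, k ≤ (Finset.univ.filter fun i => (f i : ℕ) < k).card := by
  constructor
  · rintro ⟨σ, -, hσ⟩ k hk
    have hinj : Function.Injective fun i : Fin k => σ (Fin.castLE hk i) :=
      σ.injective.comp (Fin.castLE_injective hk)
    calc k = (Finset.univ.image fun i : Fin k => σ (Fin.castLE hk i)).card := by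
          rw [Finset.card_image_of_injective _ hinj]; simp
      _ ≤ _ := by
          refine Finset.card_le_card fun x hx => ?_
          obtain ⟨i, -, rfl⟩ := Finset.mem_image.1 hx
          have h := hσ (Fin.castLE hk i)
          have hi := i.isLt
          simp only [Fin.val_castLE] at h
          simp only [Finset.mem_filter, Finset.mem_univ, true_and]
          omega
  · intro h
    refine ⟨Tuple.sort f, Tuple.monotone_sort f, fun i => ?_⟩
    by_contra! hi
    have hsub : (Finset.univ.filter fun j => (f j : ℕ) < (i : ℕ) + 1) ⊆
        (Finset.Iio i).image (Tuple.sort f) := by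
      intro x hx
      simp only [Finset.mem_filter, Finset.mem_univ, true_and] at hx
      refine Finset.mem_image.2 ⟨(Tuple.sort f).symm x, ?_, by simp⟩
      rw [Finset.mem_Iio]
      by_contra! hle
      have hmono : f (Tuple.sort f i) ≤ f (Tuple.sort f ((Tuple.sort f).symm x)) :=
        Tuple.monotone_sort f hle
      rw [Equiv.apply_symm_apply, Fin.le_def] at hmono
      omega
    have h1 := h (i + 1) i.isLt
    have h2 := (Finset.card_le_card hsub).trans Finset.card_image_le
    rw [Fin.card_Iio] at h2
    omega

lemma IsPF.of_le {n : ℕ} {f g : Fin n → Fin n} (hf : IsPF f) (h : ∀ i, g i ≤ f i) : IsPF g := by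
  rw [isPF_iff_card] at hf ⊢
  refine fun k hk => (hf k hk).trans (Finset.card_le_card fun x hx => ?_)
  have hx' := Fin.le_def.1 (h x)
  simp only [Finset.mem_filter, Finset.mem_univ, true_and] at hx ⊢
  omega

/-- The encoding only depends on the relative order of consecutive entries. -/
lemma statEnc_congr {n : ℕ} {f g : Fin n → Fin n}
    (h : ∀ i j : Fin n, (j : ℕ) = i + 1 → (g i < g j ↔ f i < f j) ∧ (g j < g i ↔ f j < f i)) :
    statEnc g = statEnc f := by
  funext i
  have hi := h ⟨i, by omega⟩ ⟨i + 1, by omega⟩ rfl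
  simp only [statEnc, hi.1, hi.2]

/-- Collapsing the values `v` and `v + 1` gives another parking function with the same encoding
unless these values occur at consecutive positions. -/
lemma exists_adjacent_of_unique {n : ℕ} {f : Fin n → Fin n} (hf : IsPF f)
    (hu : ∀ g : Fin n → Fin n, IsPF g → statEnc g = statEnc f → g = f) {m : Fin n} {v : ℕ}
    (hv : v < f m) :
    ∃ i j : Fin n, ((j : ℕ) = i + 1 ∨ (i : ℕ) = j + 1) ∧ (f i : ℕ) = v ∧ (f j : ℕ) = v + 1 := by
  by_contra! hno
  let g : Fin n → Fin n := fun j =>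
    ⟨if v < (f j : ℕ) then (f j : ℕ) - 1 else f j, by have := (f j).isLt; split_ifs <;> omega⟩
  have hg : ∀ j, (g j : ℕ) = if v < (f j : ℕ) then (f j : ℕ) - 1 else f j := fun _ => rfl
  have hgf : g = f := by
    refine hu g (hf.of_le fun i => ?_) (statEnc_congr fun i j hij => ?_)
    · rw [Fin.le_def, hg]
      split_ifs <;> omega
    · have h1 := hno i j (Or.inl hij)
      have h2 := hno j i (Or.inr hij)
      simp only [Fin.lt_def, hg]
      constructor <;> split_ifs <;> omega
  have hm := hg m
  rw [hgf, if_pos hv] at hm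
  omega

/-- Raising some of the occurrences of the maximal value `M` to `M + 1` gives another parking
function with the same encoding if enough entries are left untouched. -/
lemma card_compl_le_of_unique {n : ℕ} {f : Fin n → Fin n} (hf : IsPF f)
    (hu : ∀ g : Fin n → Fin n, IsPF g → statEnc g = statEnc f → g = f) {M : ℕ}
    (hM : ∀ i, (f i : ℕ) ≤ M) {S : Finset (Fin n)} (hS : ∀ i ∈ S, (f i : ℕ) = M)
    (hne : S.Nonempty)
    (hadj : ∀ i j : Fin n, (j : ℕ) = i + 1 → (f i : ℕ) = M → (f j : ℕ) = M → (i ∈ S ↔ j ∈ S)) :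
    Sᶜ.card ≤ M := by
  by_contra! hc
  have hMn : M + 1 < n := by
    have h1 := Finset.card_add_card_compl S
    have h2 := hne.card_pos
    rw [Fintype.card_fin] at h1
    omega
  let g : Fin n → Fin n := fun j => if j ∈ S then ⟨M + 1, hMn⟩ else f j
  have hg : ∀ j, (g j : ℕ) = if j ∈ S then M + 1 else f j := fun j => by
    simp only [g]; split_ifs <;> rfl
  have hgf : g = f := by
    refine hu g ?_ (statEnc_congr fun i j hij => ?_)
    · rw [isPF_iff_card] at hf ⊢
      intro k hk
      rcases le_or_gt k M with hkM | hkM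
      · refine (hf k hk).trans (Finset.card_le_card fun x hx => ?_)
        simp only [Finset.mem_filter, Finset.mem_univ, true_and] at hx ⊢
        have hxS : x ∉ S := fun h => by have := hS x h; omega
        rwa [hg, if_neg hxS]
      · rcases Nat.eq_or_lt_of_le hkM with rfl | hkM
        · refine (Nat.succ_le_of_lt hc).trans (Finset.card_le_card fun x hx => ?_)
          simp only [Finset.mem_filter, Finset.mem_univ, true_and]
          rw [hg, if_neg (Finset.mem_compl.1 hx)]
          have := hM x
          omega
        · rw [Finset.filter_true_of_mem, Finset.card_univ, Fintype.card_fin]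
          · exact hk
          · intro x _
            have := hM x
            rw [hg]
            split_ifs <;> omega
    · have h1 := hadj i j hij
      have h2 := hS i
      have h3 := hS j
      have h4 := hM i
      have h5 := hM j
      simp only [Fin.lt_def, hg]
      constructor <;> split_ifs <;> grind
  obtain ⟨i, hi⟩ := hne
  have h1 := hg i
  rw [hgf, if_pos hi, hS i hi] at h1
  omega

/-- A sequence in which non-maximal values occur once, and any two consecutive values occur at
consecutive positions, runs through its values along consecutive positions. -/
lemma exists_run {n M : ℕ} (hM0 : 0 < M) {F : ℕ → ℕ}
    (hinj : ∀ i < n, ∀ j < n, F i = F j → F i < M → i = j)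
    (hadj : ∀ v < M, ∃ i j, i < n ∧ j < n ∧ (j = i + 1 ∨ i = j + 1) ∧ F i = v ∧ F j = v + 1) :
    ∃ p, (p + M < n ∧ ∀ v ≤ M, F (p + v) = v) ∨ (p < n ∧ M ≤ p ∧ ∀ v ≤ M, F (p - v) = v) := by
  obtain ⟨p, q, hp, hq, hpq, hFp, hFq⟩ := hadj 0 hM0
  refine ⟨p, ?_⟩
  rcases hpq with rfl | rfl
  · left
    have key : ∀ v < M, p + v + 1 < n ∧ F (p + v) = v ∧ F (p + v + 1) = v + 1 := by
      intro v
      induction v with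
      | zero => exact fun _ => ⟨hq, hFp, hFq⟩
      | succ v ih =>
        intro hv
        obtain ⟨h1, h2, h3⟩ := ih (by omega)
        obtain ⟨i, j, hi, hj, hij, hFi, hFj⟩ := hadj (v + 1) hv
        have hi' : i = p + v + 1 := hinj i hi _ h1 (by omega) (by omega)
        rcases hij with rfl | hij
        · subst hi'
          exact ⟨hj, h3, hFj⟩
        · have : j = p + v := by omega
          subst this
          omega
    obtain ⟨h1, -, h3⟩ := key (M - 1) (by omega)
    refine ⟨by omega, fun v hv => ?_⟩
    rcases Nat.eq_or_lt_of_le hv with rfl | hv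
    · rwa [show p + (v - 1) + 1 = p + v by omega, show v - 1 + 1 = v by omega] at h3
    · exact (key v hv).2.1
  · right
    have key : ∀ v < M, v + 1 ≤ q + 1 ∧ F (q + 1 - v) = v ∧ F (q + 1 - (v + 1)) = v + 1 := by
      intro v
      induction v with
      | zero => exact fun _ => ⟨by omega, hFp, hFq⟩
      | succ v ih =>
        intro hv
        obtain ⟨h1, h2, h3⟩ := ih (by omega)
        obtain ⟨i, j, hi, hj, hij, hFi, hFj⟩ := hadj (v + 1) hv
        have hi' : i = q + 1 - (v + 1) := hinj i hi _ (by omega) (by omega) (by omega)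
        rcases hij with hij | rfl
        · have : j = q + 1 - v := by omega
          subst this
          omega
        · refine ⟨by omega, h3, ?_⟩
          rwa [show q + 1 - (v + 1 + 1) = j by omega]
    obtain ⟨h1, -, h3⟩ := key (M - 1) (by omega)
    refine ⟨hp, by omega, fun v hv => ?_⟩
    rcases Nat.eq_or_lt_of_le hv with rfl | hv
    · rwa [show v - 1 + 1 = v by omega] at h3
    · exact (key v hv).2.1

/-- A parking function determined by its encoding is `0, 1, …, M, M, …, M` or its reverse. -/
lemma eq_min_of_unique {n : ℕ} (hn : 1 ≤ n) {f : Fin n → Fin n} (hf : IsPF f)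
    (hu : ∀ g : Fin n → Fin n, IsPF g → statEnc g = statEnc f → g = f) :
    ∃ M < n, (∀ j, (f j : ℕ) = min (j : ℕ) M) ∨ ∀ j, (f j : ℕ) = min (n - 1 - j) M := by
  have : Nonempty (Fin n) := ⟨⟨0, hn⟩⟩
  obtain ⟨m, hm⟩ := Finite.exists_max f
  obtain ⟨M, hMdef⟩ : ∃ M : ℕ, (f m : ℕ) = M := ⟨_, rfl⟩
  have hM : ∀ i, (f i : ℕ) ≤ M := fun i => hMdef ▸ hm i
  refine ⟨M, hMdef ▸ (f m).isLt, ?_⟩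
  rcases Nat.eq_zero_or_pos M with rfl | hM0
  · left
    intro j
    have := hM j
    omega
  have hadj : ∀ v < M, ∃ i j : Fin n, ((j : ℕ) = i + 1 ∨ (i : ℕ) = j + 1) ∧ (f i : ℕ) = v ∧
      (f j : ℕ) = v + 1 := fun v hv => exists_adjacent_of_unique hf hu (hMdef.symm ▸ hv)
  have hcard : (Finset.univ.filter fun i => (f i : ℕ) < M).card ≤ M := by
    refine le_trans (Finset.card_le_card ?_) (card_compl_le_of_unique hf hu hM
      (S := Finset.univ.filter fun i => (f i : ℕ) = M) (by simp) ⟨m, by simpa using hMdef⟩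
      (fun i j _ hi hj => by simp [hi, hj]))
    intro x hx
    simp only [Finset.mem_filter, Finset.mem_univ, true_and, Finset.mem_compl] at hx ⊢
    omega
  have hinj : ∀ i j, (f i : ℕ) = f j → (f i : ℕ) < M → i = j := by
    intro i j hij hi
    have himg : Finset.range M ⊆
        (Finset.univ.filter fun i => (f i : ℕ) < M).image fun i => (f i : ℕ) := by
      intro v hv
      rw [Finset.mem_range] at hv
      obtain ⟨x, -, -, hx, -⟩ := hadj v hv
      exact Finset.mem_image.2 ⟨x, by simp [hx, hv], hx⟩
    have h1 := Finset.card_le_card himg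
    rw [Finset.card_range] at h1
    exact Finset.card_image_iff.1 (le_antisymm Finset.card_image_le (hcard.trans h1))
      (by simpa using hi) (by simpa using hij ▸ hi) hij
  let F : ℕ → ℕ := fun j => if h : j < n then f ⟨j, h⟩ else 0
  have hF : ∀ j : Fin n, F j = f j := fun j => by simp [F]
  obtain ⟨p, ⟨hp, hrun⟩ | ⟨hp, hpM, hrun⟩⟩ := exists_run (n := n) hM0 (F := F)
    (fun i hi j hj hij hlt => by
      have h := hinj ⟨i, hi⟩ ⟨j, hj⟩
      rw [← hF, ← hF] at h
      exact Fin.mk.inj_iff.1 (h hij hlt))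
    (fun v hv => by
      obtain ⟨i, j, h1, h2, h3⟩ := hadj v hv
      exact ⟨i, j, i.isLt, j.isLt, h1, by rw [hF, h2], by rw [hF, h3]⟩)
  · have hrun' : ∀ j : Fin n, ∀ v ≤ M, (j : ℕ) = p + v → (f j : ℕ) = v := fun j v hv hj => by
      rw [← hF, hj, hrun v hv]
    have hout : ∀ j : Fin n, ¬ (p ≤ (j : ℕ) ∧ (j : ℕ) < p + M) → (f j : ℕ) = M := by
      intro j hj
      by_contra hne
      have hlt : (f j : ℕ) < M := lt_of_le_of_ne (hM j) hne
      have := hrun' ⟨p + f j, by omega⟩ (f j) hlt.le rfl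
      have := Fin.ext_iff.1 (hinj j _ this.symm hlt)
      simp only at this
      omega
    left
    have hp0 : p = 0 := by
      by_contra hp0
      have hpn : p < n := by omega
      have h := card_compl_le_of_unique hf hu hM (S := Finset.Iio ⟨p, hpn⟩)
        (fun i hi => hout i (by rw [Finset.mem_Iio, Fin.lt_def] at hi; simp only at hi; omega))
        ⟨⟨0, hn⟩, by rw [Finset.mem_Iio, Fin.lt_def]; simp only; omega⟩
        (fun i j hij hi hj => by
          have := hrun' j 0 (by omega)
          simp only [Finset.mem_Iio, Fin.lt_def]
          omega)
      rw [Finset.card_compl, Fin.card_Iio, Fintype.card_fin] at h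
      simp only at h
      omega
    intro j
    rcases lt_or_ge (j : ℕ) M with hj | hj
    · rw [hrun' j j hj.le (by omega)]
      omega
    · rw [hout j (by omega)]
      omega
  · have hrun' : ∀ j : Fin n, ∀ v ≤ M, (j : ℕ) = p - v → (f j : ℕ) = v := fun j v hv hj => by
      rw [← hF, hj, hrun v hv]
    have hout : ∀ j : Fin n, ¬ ((j : ℕ) ≤ p ∧ p < (j : ℕ) + M) → (f j : ℕ) = M := by
      intro j hj
      by_contra hne
      have hlt : (f j : ℕ) < M := lt_of_le_of_ne (hM j) hne
      have := hrun' ⟨p - f j, by omega⟩ (f j) hlt.le rfl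
      have := Fin.ext_iff.1 (hinj j _ this.symm hlt)
      simp only at this
      omega
    right
    have hpn : p = n - 1 := by
      by_contra hpn
      have h := card_compl_le_of_unique hf hu hM (S := Finset.Ioi ⟨p, hp⟩)
        (fun i hi => hout i (by rw [Finset.mem_Ioi, Fin.lt_def] at hi; simp only at hi; omega))
        ⟨⟨n - 1, by omega⟩, by rw [Finset.mem_Ioi, Fin.lt_def]; simp only; omega⟩
        (fun i j hij hi hj => by
          have := hrun' i 0 (by omega)
          simp only [Finset.mem_Ioi, Fin.lt_def]
          omega)
      rw [Finset.card_compl, Fin.card_Ioi, Fintype.card_fin] at h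
      simp only at h
      omega
    intro j
    have hjn := j.isLt
    rcases lt_or_ge (n - 1 - (j : ℕ)) M with hj | hj
    · rw [hrun' j (n - 1 - j) hj.le (by omega)]
      omega
    · rw [hout j (by omega)]
      omega

lemma statEnc_eq_A_iff {n : ℕ} (f : Fin n → Fin n) (i : Fin (n - 1)) :
    statEnc f i = Letter.A ↔ f ⟨i, by omega⟩ < f ⟨i + 1, by omega⟩ := by
  simp only [statEnc]
  split_ifs <;> simp_all

lemma statEnc_eq_D_iff {n : ℕ} (f : Fin n → Fin n) (i : Fin (n - 1)) :
    statEnc f i = Letter.D ↔ f ⟨i + 1, by omega⟩ < f ⟨i, by omega⟩ := by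
  simp only [statEnc]
  split_ifs with h1 h2
  · simp [h1.le]
  all_goals simp_all

lemma statEnc_eq_T_iff {n : ℕ} (f : Fin n → Fin n) (i : Fin (n - 1)) :
    statEnc f i = Letter.T ↔ f ⟨i + 1, by omega⟩ = f ⟨i, by omega⟩ := by
  simp only [statEnc]
  split_ifs with h1 h2
  · simp [h1.ne']
  · simp [h2.ne]
  · simp [le_antisymm (not_lt.1 h1) (not_lt.1 h2)]

lemma statEnc_of_eq_min {n M : ℕ} {f : Fin n → Fin n} (hf : ∀ j, (f j : ℕ) = min (j : ℕ) M)
    (i : Fin (n - 1)) : statEnc f i = if (i : ℕ) < M then Letter.A else Letter.T := by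
  split_ifs with h
  · rw [statEnc_eq_A_iff, Fin.lt_def, hf, hf]
    simp only
    omega
  · rw [statEnc_eq_T_iff, Fin.ext_iff, hf, hf]
    simp only
    omega

lemma statEnc_of_eq_min_rev {n M : ℕ} (hM : M < n) {f : Fin n → Fin n}
    (hf : ∀ j, (f j : ℕ) = min (n - 1 - j) M) (i : Fin (n - 1)) :
    statEnc f i = if (i : ℕ) < n - 1 - M then Letter.T else Letter.D := by
  have hi := i.isLt
  split_ifs with h
  · rw [statEnc_eq_T_iff, Fin.ext_iff, hf, hf]
    simp only
    omega
  · rw [statEnc_eq_D_iff, Fin.lt_def, hf, hf]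
    simp only
    omega

lemma isPF_id {n : ℕ} : IsPF (id : Fin n → Fin n) :=
  ⟨Equiv.refl _, monotone_id, fun _ => le_rfl⟩

lemma isPF_rev {n : ℕ} : IsPF (Fin.rev : Fin n → Fin n) := by
  refine ⟨Fin.revPerm, fun i j h => ?_, fun i => ?_⟩ <;> simp [*]

lemma IsPF.le_card {n : ℕ} {f : Fin n → Fin n} (hf : IsPF f) (i : Fin n) :
    (f i : ℕ) ≤ (Finset.univ.filter fun j => f j < f i).card := by
  simpa only [Fin.lt_def] using (isPF_iff_card f).1 hf (f i) (f i).isLt.le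

lemma eq_min_of_statEnc {n a : ℕ} (ha : a < n) {f : Fin n → Fin n} (hf : IsPF f)
    (hw : ∀ i, statEnc f i = if (i : ℕ) < a then Letter.A else Letter.T) (j : Fin n) :
    (f j : ℕ) = min (j : ℕ) a := by
  have hA : ∀ i (hi : i < a), (f ⟨i, by omega⟩ : ℕ) < f ⟨i + 1, by omega⟩ := fun i hi =>
    (statEnc_eq_A_iff f ⟨i, by omega⟩).1 ((hw _).trans (if_pos hi))
  have hT : ∀ i (hi : a ≤ i) (hin : i + 1 < n), f ⟨i + 1, hin⟩ = f ⟨i, by omega⟩ :=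
    fun i hi hin => (statEnc_eq_T_iff f ⟨i, by omega⟩).1 ((hw _).trans (if_neg (by simpa using hi)))
  have hconst : ∀ d (hd : a + d < n), f ⟨a + d, hd⟩ = f ⟨a, ha⟩ := by
    intro d
    induction d with
    | zero => exact fun _ => rfl
    | succ d ih => exact fun hd => (hT (a + d) (by omega) hd).trans (ih (by omega))
  have hlow : ∀ i (hi : i ≤ a), i ≤ (f ⟨i, by omega⟩ : ℕ) := by
    intro i
    induction i with
    | zero => exact fun _ => Nat.zero_le _
    | succ i ih =>
      intro hi
      have h1 := hA i hi
      have h2 := ih (by omega)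
      omega
  have hupp : ∀ d (hd : d ≤ a), (f ⟨a - d, by omega⟩ : ℕ) + d ≤ f ⟨a, ha⟩ := by
    intro d
    induction d with
    | zero => exact fun _ => le_rfl
    | succ d ih =>
      intro hd
      have h1 := hA (a - (d + 1)) (by omega)
      have h2 := ih (by omega)
      simp only [show a - (d + 1) + 1 = a - d by omega] at h1
      omega
  have htop : (f ⟨a, ha⟩ : ℕ) ≤ a := by
    refine (hf.le_card ⟨a, ha⟩).trans ((Finset.card_le_card fun x hx => ?_).trans
      (Fin.card_Iio (⟨a, ha⟩ : Fin n)).le)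
    simp only [Finset.mem_filter, Finset.mem_univ, true_and] at hx
    rw [Finset.mem_Iio]
    by_contra! hle
    rw [Fin.le_def] at hle
    have := hconst (x - a) (by simp only at hle; omega)
    simp only [show a + ((x : ℕ) - a) = x by simp only at hle; omega] at this
    exact hx.ne this
  obtain ⟨j, hj⟩ := j
  rcases le_or_gt j a with h | h
  · have h1 := hlow j h
    have h2 := hupp (a - j) (by omega)
    simp only [show a - (a - j) = j by omega] at h2
    simp only
    omega
  · have h1 := hconst (j - a) (by omega)
    simp only [show a + (j - a) = j by omega] at h1
    have h2 := hlow a le_rfl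
    rw [h1]
    simp only
    omega

lemma eq_min_rev_of_statEnc {n a : ℕ} (ha : a < n) {f : Fin n → Fin n} (hf : IsPF f)
    (hw : ∀ i, statEnc f i = if (i : ℕ) < a then Letter.T else Letter.D) (j : Fin n) :
    (f j : ℕ) = min (n - 1 - j) (n - 1 - a) := by
  have hD : ∀ i (hi : a ≤ i) (hin : i + 1 < n),
      (f ⟨i + 1, hin⟩ : ℕ) < f ⟨i, by omega⟩ := fun i hi hin =>
    (statEnc_eq_D_iff f ⟨i, by omega⟩).1 ((hw _).trans (if_neg (by simpa using hi)))
  have hT : ∀ i (hi : i < a), f ⟨i + 1, by omega⟩ = f ⟨i, by omega⟩ :=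
    fun i hi => (statEnc_eq_T_iff f ⟨i, by omega⟩).1 ((hw _).trans (if_pos hi))
  have hconst : ∀ d (hd : d ≤ a), f ⟨a - d, by omega⟩ = f ⟨a, ha⟩ := by
    intro d
    induction d with
    | zero => exact fun _ => rfl
    | succ d ih =>
      intro hd
      have h := hT (a - (d + 1)) (by omega)
      simp only [show a - (d + 1) + 1 = a - d by omega] at h
      exact h.symm.trans (ih (by omega))
  have hlow : ∀ d (hd : d ≤ n - 1 - a), d ≤ (f ⟨n - 1 - d, by omega⟩ : ℕ) := by
    intro d
    induction d with
    | zero => exact fun _ => Nat.zero_le _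
    | succ d ih =>
      intro hd
      have h1 := hD (n - 1 - (d + 1)) (by omega) (by omega)
      have h2 := ih (by omega)
      simp only [show n - 1 - (d + 1) + 1 = n - 1 - d by omega] at h1
      omega
  have hupp : ∀ d (hd : a + d < n), (f ⟨a + d, hd⟩ : ℕ) + d ≤ f ⟨a, ha⟩ := by
    intro d
    induction d with
    | zero => exact fun _ => le_rfl
    | succ d ih =>
      intro hd
      have h1 := hD (a + d) (by omega) hd
      have h2 := ih (by omega)
      simp only [← add_assoc]
      omega
  have htop : (f ⟨a, ha⟩ : ℕ) ≤ n - 1 - a := by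
    refine (hf.le_card ⟨a, ha⟩).trans ((Finset.card_le_card fun x hx => ?_).trans
      (Fin.card_Ioi (⟨a, ha⟩ : Fin n)).le)
    simp only [Finset.mem_filter, Finset.mem_univ, true_and] at hx
    rw [Finset.mem_Ioi]
    by_contra! hle
    rw [Fin.le_def] at hle
    have := hconst (a - x) (by omega)
    simp only [show a - (a - (x : ℕ)) = x by simp only at hle; omega] at this
    exact hx.ne this
  obtain ⟨j, hj⟩ := j
  have h2 := hlow (n - 1 - a) le_rfl
  simp only [show n - 1 - (n - 1 - a) = a by omega] at h2
  rcases le_or_gt a j with h | h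
  · have h1 := hlow (n - 1 - j) (by omega)
    have h3 := hupp (j - a) (by omega)
    simp only [show a + (j - a) = j by omega] at h3
    simp only [show n - 1 - (n - 1 - j) = j by omega] at h1
    simp only
    omega
  · have h1 := hconst (a - j) (by omega)
    simp only [show a - (a - j) = j by omega] at h1
    rw [h1]
    simp only
    omega

/-- A word `w ∈ {A,D,T}^{n-1}` is the statistic encoding of exactly one parking function
of length `n` if and only if `w` consists of some number of `A`'s followed by `T`'s, or
some number of `T`'s followed by `D`'s. -/
theorem stmt13 (n : ℕ) (hn : 1 ≤ n) (w : Fin (n - 1) → Letter) :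
    (∃! f : Fin n → Fin n, IsPF f ∧ statEnc f = w) ↔
      ((∃ a : ℕ, ∀ i : Fin (n - 1), w i = if (i : ℕ) < a then Letter.A else Letter.T) ∨
        (∃ a : ℕ, ∀ i : Fin (n - 1), w i = if (i : ℕ) < a then Letter.T else Letter.D)) := by
  constructor
  · rintro ⟨f, ⟨hf, rfl⟩, hu⟩
    obtain ⟨M, hM, h | h⟩ := eq_min_of_unique hn hf fun g hg hgf => hu g ⟨hg, hgf⟩
    · exact Or.inl ⟨M, statEnc_of_eq_min h⟩
    · exact Or.inr ⟨n - 1 - M, statEnc_of_eq_min_rev hM h⟩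
  · rintro (⟨a, ha⟩ | ⟨a, ha⟩)
    · have hw : ∀ i, w i = if (i : ℕ) < min a (n - 1) then Letter.A else Letter.T := fun i => by
        simp only [ha, lt_min_iff, i.isLt, and_true]
      refine ⟨fun j => ⟨min (j : ℕ) (min a (n - 1)), by omega⟩, ⟨?_, ?_⟩, ?_⟩
      · exact isPF_id.of_le fun j => Fin.le_def.2 (min_le_left _ _)
      · funext i
        rw [hw, statEnc_of_eq_min fun _ => rfl]
      · rintro g ⟨hg, rfl⟩
        funext j
        exact Fin.ext (eq_min_of_statEnc (by omega) hg hw j)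
    · have hw : ∀ i, w i = if (i : ℕ) < min a (n - 1) then Letter.T else Letter.D := fun i => by
        simp only [ha, lt_min_iff, i.isLt, and_true]
      refine ⟨fun j => ⟨min (n - 1 - j) (n - 1 - min a (n - 1)), by omega⟩, ⟨?_, ?_⟩, ?_⟩
      · refine isPF_rev.of_le fun j => Fin.le_def.2 ?_
        rw [Fin.val_rev]
        simp only
        omega
      · funext i
        rw [hw, statEnc_of_eq_min_rev (M := n - 1 - min a (n - 1)) (by omega) fun _ => rfl]
        congr 2
        rw [Nat.sub_sub_self (min_le_right _ _)]
      · rintro g ⟨hg, rfl⟩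
        funext j
        exact Fin.ext (eq_min_rev_of_statEnc (by omega) hg hw j)
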